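/- arXiv:2410.03605 — 4 statements merged into one kernel-verified Lean document; each statement's English description precedes it below -/
import Mathlib

section
/- Fourier symbol of source iteration (SI). Let N ∈ ℕ, let μ_n, w_n, α_n ∈ ℝ for n = 1, …, N, let Σ_t > 0, h > 0, ω, c ∈ ℝ, set θ = Σ_t h ω, assume cos(θ/2) ≠ 0, and define Λ = (2/(Σ_t h))·tan(θ/2). For each n set D₁ₙ = 1 + i·α_n·Σ_t·h·Λ/2 and D₂ₙ = 1 + i·μ_n·Λ/D₁ₙ, and assume D₂ₙ ≠ 0. Suppose a_n, b_n ∈ ℂ satisfy, for every j ∈ ℤ, the discrete sweep equation (μ_n/h)·(b_n·e^{iθ(j+1/2)} − b_n·e^{iθ(j−1/2)}) + Σ_t·a_n·e^{iθj} = (c/2)·Σ_t·e^{iθj} together with the closure a_n = ((1−α_n)/2)·b_n·e^{−iθ/2} + ((1+α_n)/2)·b_n·e^{iθ/2}. Then the scalar-flux amplitude β = Σ_{n=1}^{N} w_n·a_n equals ϱ_SI(ω) = (c/2)·Σ_{n=1}^{N} w_n / (1 + i·μ_n·Λ/(1 + i·α_n·Σ_t·h·Λ/2)). In other words, one source iteration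 multiplies the Fourier error mode e^{iΣ_tωx_j} of the scalar flux by ϱ_SI(ω). -/
/-- Along the imaginary direction with real coefficients, `1 + i x` never vanishes. -/
theorem one_add_I_mul_ofReal_ne_zero (x : ℝ) : 1 + Complex.I * (x : ℂ) ≠ 0 := by
  intro hx
  simpa using congrArg Complex.re hx

/-- The cell-centred amplitude solved from the sweep equation and the weighted-diamond closure,
with `C` and `S` the cosine and sine of half the phase and `D` the closure factor. -/
theorem mul_one_add_div_eq_of_sweep {a b C S D μ α σ h Λ q : ℂ}
    (hσ : σ ≠ 0) (hh : h ≠ 0) (hD : D ≠ 0) (hDdef : D = 1 + Complex.I * α * σ * h * Λ / 2)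
    (hS : S = C * (σ * h * Λ / 2))
    (hsweep : μ / h * (b * (C + Complex.I * S) - b * (C - Complex.I * S)) + σ * a = q * σ)
    (hclosure : a = (1 - α) / 2 * b * (C - Complex.I * S)
      + (1 + α) / 2 * b * (C + Complex.I * S)) :
    a * (1 + Complex.I * μ * Λ / D) = q := by
  have ha : a = b * C * D := by rw [hclosure, hDdef, hS]; ring
  have hsum : σ * (a + Complex.I * μ * Λ * (b * C)) = σ * q := by
    rw [mul_comm σ q, ← hsweep, hS]
    field_simp
    ring
  rw [← mul_left_cancel₀ hσ hsum, ha]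
  field_simp


/-- Fourier symbol of source iteration (SI): if the per-direction amplitudes
`a n`, `b n` satisfy the discrete weighted-diamond sweep equation for every
cell index `j` together with the weighted-diamond closure, then the
scalar-flux amplitude `β = ∑ n, w n * a n` equals the SI symbol
`(c/2) · ∑ n, w n / (1 + i μ n Λ / (1 + i α n σt h Λ / 2))`. -/
theorem si_fourier_symbol
    (N : ℕ) (μ w α : Fin N → ℝ) (σt h ω c : ℝ)
    (hσt : 0 < σt) (hh : 0 < h)
    (θ : ℝ) (hθ : θ = σt * h * ω)
    (hcos : Real.cos (θ / 2) ≠ 0)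
    (Λ : ℝ) (hΛ : Λ = (2 / (σt * h)) * Real.tan (θ / 2))
    (D₁ D₂ : Fin N → ℂ)
    (hD₁ : ∀ n, D₁ n = 1 + Complex.I * (α n : ℂ) * (σt : ℂ) * (h : ℂ) * (Λ : ℂ) / 2)
    (hD₂def : ∀ n, D₂ n = 1 + Complex.I * (μ n : ℂ) * (Λ : ℂ) / D₁ n)
    (hD₂ : ∀ n, D₂ n ≠ 0)
    (a b : Fin N → ℂ)
    (hsweep : ∀ n, ∀ j : ℤ,
      ((μ n : ℂ) / (h : ℂ)) *
          (b n * Complex.exp (Complex.I * (θ : ℂ) * ((j : ℂ) + 1/2))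
            - b n * Complex.exp (Complex.I * (θ : ℂ) * ((j : ℂ) - 1/2)))
        + (σt : ℂ) * a n * Complex.exp (Complex.I * (θ : ℂ) * (j : ℂ))
        = ((c : ℂ) / 2) * (σt : ℂ) * Complex.exp (Complex.I * (θ : ℂ) * (j : ℂ)))
    (hclosure : ∀ n,
      a n = (((1 : ℂ) - (α n : ℂ)) / 2) * b n * Complex.exp (-(Complex.I * (θ : ℂ)) / 2)
        + (((1 : ℂ) + (α n : ℂ)) / 2) * b n * Complex.exp (Complex.I * (θ : ℂ) / 2)) :
    ∑ n, (w n : ℂ) * a n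
      = ((c : ℂ) / 2) * ∑ n, (w n : ℂ) /
          (1 + Complex.I * (μ n : ℂ) * (Λ : ℂ) /
            (1 + Complex.I * (α n : ℂ) * (σt : ℂ) * (h : ℂ) * (Λ : ℂ) / 2)) := by
  have hσ' : (σt : ℂ) ≠ 0 := Complex.ofReal_ne_zero.mpr hσt.ne'
  have hh' : (h : ℂ) ≠ 0 := Complex.ofReal_ne_zero.mpr hh.ne'
  have hpos : Complex.exp (Complex.I * θ / 2)
      = (Real.cos (θ / 2) : ℂ) + Complex.I * (Real.sin (θ / 2) : ℂ) := by
    rw [show Complex.I * (θ : ℂ) / 2 = ((θ / 2 : ℝ) : ℂ) * Complex.I by push_cast; ring,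
      Complex.exp_mul_I, Complex.ofReal_cos, Complex.ofReal_sin]
    ring
  have hneg : Complex.exp (-(Complex.I * θ) / 2)
      = (Real.cos (θ / 2) : ℂ) - Complex.I * (Real.sin (θ / 2) : ℂ) := by
    rw [show -(Complex.I * (θ : ℂ)) / 2 = (-(θ / 2 : ℝ) : ℂ) * Complex.I by push_cast; ring,
      Complex.exp_mul_I, Complex.cos_neg, Complex.sin_neg, Complex.ofReal_cos,
      Complex.ofReal_sin]
    ring
  have hS : (Real.sin (θ / 2) : ℂ) = (Real.cos (θ / 2) : ℂ) * ((σt : ℂ) * h * Λ / 2) := by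
    have hreal : Real.sin (θ / 2) = Real.cos (θ / 2) * (σt * h * Λ / 2) := by
      rw [hΛ, Real.tan_eq_sin_div_cos]
      field_simp
    exact_mod_cast hreal
  rw [Finset.mul_sum]
  refine Finset.sum_congr rfl fun n _ => ?_
  have hD : D₁ n ≠ 0 := by
    rw [hD₁ n]
    convert one_add_I_mul_ofReal_ne_zero (α n * σt * h * Λ / 2) using 2
    push_cast
    ring
  have hcell : (μ n : ℂ) / h * (b n * Complex.exp (Complex.I * θ / 2)
      - b n * Complex.exp (-(Complex.I * θ) / 2)) + σt * a n = (c : ℂ) / 2 * σt := by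
    convert hsweep n 0 using 1
    · rw [Int.cast_zero, mul_zero, Complex.exp_zero, mul_one, zero_add, zero_sub]
      ring_nf
    · simp
  have hcl := hclosure n
  rw [hpos, hneg] at hcell hcl
  have key := mul_one_add_div_eq_of_sweep hσ' hh' hD (hD₁ n) hS hcell hcl
  rw [← hD₂def n] at key
  rw [← hD₁ n, ← hD₂def n, ← key]
  field_simp [hD₂ n]
end

section
/- Fourier symbol of the CQD (consistent quasidiffusion) low-order solve. Let Σ_t > 0, Σ_a ≥ 0, h > 0, ω ∈ ℝ, set θ = Σ_t h ω, and let β, γ, B ∈ ℂ. Assume the denominator D = (2/(3Σ_t))·(1 − cos θ) + h²·Σ_a is nonzero. Suppose that for every j ∈ ℤ the central-difference linearized diffusion equation holds: (1/(3Σ_t h²))·(γ·e^{iθ(j−1)} − 2γ·e^{iθj} + γ·e^{iθ(j+1)}) − Σ_a·γ·e^{iθj} = (1/(3Σ_t h²))·(β·e^{iθ(j−1)} − 2β·e^{iθj} + β·e^{iθ(j+1)}) + (1/h)·(B·e^{iθ(j+1/2)} − B·e^{iθ(j−1/2)}). Then γ = β − (2i·h·sin(θ/2)·B + h²·Σ_a·β)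 / D. -/
/-- Fourier symbol of the CQD low-order solve: if the amplitudes `β`, `γ`, `B`
satisfy the central-difference linearized diffusion equation for every cell
index `j`, then `γ = β - (2i·h·sin(θ/2)·B + h²·σa·β)/D` with
`D = (2/(3σt))·(1 - cos θ) + h²·σa`. -/
theorem cqd_low_order_fourier_symbol
    (σt σa h ω : ℝ) (hσt : 0 < σt) (hσa : 0 ≤ σa) (hh : 0 < h)
    (θ : ℝ) (hθ : θ = σt * h * ω)
    (β γ B : ℂ)
    (D : ℂ)
    (hDdef : D = ((2 / (3 * σt) : ℝ) : ℂ) * (1 - (Real.cos θ : ℂ)) + ((h ^ 2 * σa : ℝ) : ℂ))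
    (hD : D ≠ 0)
    (heq : ∀ j : ℤ,
      ((1 / (3 * σt * h ^ 2) : ℝ) : ℂ) *
          (γ * Complex.exp (Complex.I * (θ : ℂ) * ((j : ℂ) - 1))
            - 2 * γ * Complex.exp (Complex.I * (θ : ℂ) * (j : ℂ))
            + γ * Complex.exp (Complex.I * (θ : ℂ) * ((j : ℂ) + 1)))
        - (σa : ℂ) * γ * Complex.exp (Complex.I * (θ : ℂ) * (j : ℂ))
      = ((1 / (3 * σt * h ^ 2) : ℝ) : ℂ) *
          (β * Complex.exp (Complex.I * (θ : ℂ) * ((j : ℂ) - 1))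
            - 2 * β * Complex.exp (Complex.I * (θ : ℂ) * (j : ℂ))
            + β * Complex.exp (Complex.I * (θ : ℂ) * ((j : ℂ) + 1)))
        + ((1 / h : ℝ) : ℂ) *
          (B * Complex.exp (Complex.I * (θ : ℂ) * ((j : ℂ) + 1/2))
            - B * Complex.exp (Complex.I * (θ : ℂ) * ((j : ℂ) - 1/2)))) :
    γ = β - (2 * Complex.I * (h : ℂ) * (Real.sin (θ / 2) : ℂ) * B
        + ((h ^ 2 * σa : ℝ) : ℂ) * β) / D := by
  have hcos (z : ℂ) : Complex.exp (Complex.I * z) + Complex.exp (-(Complex.I * z))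
      = 2 * Complex.cos z := by
    rw [Complex.two_cos, mul_comm z, neg_mul, mul_comm z]
  have hsin (z : ℂ) : Complex.exp (Complex.I * z) - Complex.exp (-(Complex.I * z))
      = 2 * Complex.I * Complex.sin z := by
    rw [Complex.sin, mul_comm Complex.I z, neg_mul]
    linear_combination
      (-(Complex.exp (-(z * Complex.I)) - Complex.exp (z * Complex.I))) * Complex.I_sq
  have h0 := heq 0
  have hc := hcos θ
  have hs := hsin (θ / 2)
  rw [← mul_div_assoc] at hs
  simp only [Int.cast_zero, zero_sub, zero_add, mul_zero, mul_one, mul_neg,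
    Complex.exp_zero] at h0
  have hhC : (h : ℂ) ≠ 0 := by exact_mod_cast hh.ne'
  have hσC : (σt : ℂ) ≠ 0 := by exact_mod_cast hσt.ne'
  rw [eq_sub_iff_add_eq, ← eq_sub_iff_add_eq', div_eq_iff hD, hDdef]
  push_cast at h0 ⊢
  field_simp at h0 ⊢
  linear_combination -h0 + (γ - β) * hc - 3 * (σt : ℂ) * h * B * hs
end

section
/- CQD Fourier symbol for diamond differencing (DD). Let N ∈ ℕ, let μ_n, w_n ∈ ℝ for n = 1, …, N with an involution σ of {1, …, N} satisfying μ_{σ(n)} = −μ_n and w_{σ(n)} = w_n. Let Σ_t > 0, Σ_a ≥ 0, h > 0, ω, c ∈ ℝ, set θ = Σ_t h ω, assume cos(θ/2) ≠ 0, define Λ = (2/(Σ_t h))·tan(θ/2), and assume D = (2/(3Σ_t))·(1 − cos θ) + h²·Σ_a ≠ 0. Define a_n = (c/2)/(1 + i·μ_n·Λ), b_n = a_n/cos(θ/2), β = Σ_n w_n·a_n, and γ = β − (2i·h·sin(θ/2)·Σ_n b_n·μ_n·w_n + h²·Σ_a·β)/D. Then γ = β − ( h·c·Λ·tan(θ/2)·Σ_{n=1}^{N}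 μ_n²·w_n/(1 + μ_n²·Λ²) + h²·Σ_a·β ) / D. -/
/-- Over a quadrature set symmetric under `μ ↦ -μ`, only the odd part of the transport resolvent
`1 / (1 + i μ Λ)` contributes to its first moment. -/
theorem sum_div_one_add_I_mul_of_symmetric {ι : Type*} [Fintype ι] (μ w : ι → ℝ)
    (σ : Equiv.Perm ι) (hμ : ∀ n, μ (σ n) = -μ n) (hw : ∀ n, w (σ n) = w n) (Λ : ℝ) :
    ∑ n, (μ n : ℂ) * w n / (1 + Complex.I * μ n * Λ) =
      -Complex.I * Λ * ∑ n, ((μ n ^ 2 * w n : ℝ) : ℂ) / (1 + ((μ n ^ 2 * Λ ^ 2 : ℝ) : ℂ)) := by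
  have one_add_ne (x : ℝ) : 1 + Complex.I * x * Λ ≠ 0 := fun h => by
    simpa using congrArg Complex.re h
  have hreindex := Equiv.sum_comp σ fun n => (μ n : ℂ) * w n / (1 + Complex.I * μ n * Λ)
  have hadd : ∑ n, (μ n : ℂ) * w n / (1 + Complex.I * μ n * Λ) +
      ∑ n, (μ (σ n) : ℂ) * w (σ n) / (1 + Complex.I * μ (σ n) * Λ) =
      2 * (-Complex.I * Λ *
        ∑ n, ((μ n ^ 2 * w n : ℝ) : ℂ) / (1 + ((μ n ^ 2 * Λ ^ 2 : ℝ) : ℂ))) := by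
    rw [← Finset.sum_add_distrib, ← mul_assoc, Finset.mul_sum]
    refine Finset.sum_congr rfl fun n _ => ?_
    have h₁ := one_add_ne (μ n)
    have h₂ := one_add_ne (-μ n)
    have hprod : 1 + ((μ n ^ 2 * Λ ^ 2 : ℝ) : ℂ) =
        (1 + Complex.I * μ n * Λ) * (1 + Complex.I * ((-μ n : ℝ) : ℂ) * Λ) := by
      push_cast
      linear_combination (μ n : ℂ) ^ 2 * Λ ^ 2 * Complex.I_sq
    rw [hμ, hw, hprod, div_add_div _ _ h₁ h₂, mul_div_assoc']
    congr 1
    push_cast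
    ring
  linear_combination (hadd - hreindex) / 2

/-- CQD Fourier symbol for diamond differencing (DD): with the symmetric
quadrature set, `a n = (c/2)/(1 + i μ n Λ)`, `b n = a n / cos(θ/2)`,
`β = ∑ n, w n · a n`, and the general CQD symbol `γ`, one has
`γ = β - (h·c·Λ·tan(θ/2)·∑ n, μ n² w n/(1 + μ n² Λ²) + h²·σa·β)/D`. -/
theorem cqd_fourier_symbol_dd
    (N : ℕ) (μ w : Fin N → ℝ) (σ : Equiv.Perm (Fin N))
    (hσ : ∀ n, σ (σ n) = n)
    (hμ : ∀ n, μ (σ n) = - μ n) (hw : ∀ n, w (σ n) = w n)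
    (σt σa h ω c : ℝ) (hσt : 0 < σt) (hσa : 0 ≤ σa) (hh : 0 < h)
    (θ : ℝ) (hθ : θ = σt * h * ω)
    (hcos : Real.cos (θ / 2) ≠ 0)
    (Λ : ℝ) (hΛ : Λ = (2 / (σt * h)) * Real.tan (θ / 2))
    (D : ℂ)
    (hDdef : D = ((2 / (3 * σt) : ℝ) : ℂ) * (1 - (Real.cos θ : ℂ)) + ((h ^ 2 * σa : ℝ) : ℂ))
    (hD : D ≠ 0)
    (a b : Fin N → ℂ)
    (ha : ∀ n, a n = ((c : ℂ) / 2) / (1 + Complex.I * (μ n : ℂ) * (Λ : ℂ)))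
    (hb : ∀ n, b n = a n / ((Real.cos (θ / 2) : ℝ) : ℂ))
    (β γ : ℂ)
    (hβ : β = ∑ n, (w n : ℂ) * a n)
    (hγ : γ = β - (2 * Complex.I * (h : ℂ) * (Real.sin (θ / 2) : ℂ) *
          (∑ n, b n * (μ n : ℂ) * (w n : ℂ)) + ((h ^ 2 * σa : ℝ) : ℂ) * β) / D) :
    γ = β - (((h * c * Λ * Real.tan (θ / 2) : ℝ) : ℂ) *
          (∑ n, ((μ n ^ 2 * w n : ℝ) : ℂ) / (1 + ((μ n ^ 2 * Λ ^ 2 : ℝ) : ℂ)))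
        + ((h ^ 2 * σa : ℝ) : ℂ) * β) / D := by
  have hcos' : ((Real.cos (θ / 2) : ℝ) : ℂ) ≠ 0 := Complex.ofReal_ne_zero.mpr hcos
  have hmoment : ∑ n, b n * (μ n : ℂ) * (w n : ℂ) =
      (c : ℂ) / 2 / ((Real.cos (θ / 2) : ℝ) : ℂ) *
        ∑ n, (μ n : ℂ) * w n / (1 + Complex.I * μ n * Λ) := by
    rw [Finset.mul_sum]
    refine Finset.sum_congr rfl fun n _ => ?_
    rw [hb, ha]
    ring
  rw [hγ, hmoment, sum_div_one_add_I_mul_of_symmetric μ w σ hμ hw, Real.tan_eq_sin_div_cos]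
  congr 3
  generalize ∑ n, ((μ n ^ 2 * w n : ℝ) : ℂ) / (1 + ((μ n ^ 2 * Λ ^ 2 : ℝ) : ℂ)) = S
  push_cast at hcos' ⊢
  field_simp
  linear_combination -((h : ℂ) * Complex.sin (θ / 2) * c * Λ * S) * Complex.I_sq
end

section
/- Cancellation of the second-moment perturbation: the linearized CQD current equals the linearized NDA current. Let Σ_t > 0, Φ₀ ∈ ℝ with Φ₀ ≠ 0, and let p, q, r, s : ℝ → ℝ with p, q, r differentiable on ℝ. For (ε, x) ∈ ℝ × ℝ define K(ε, x) = −(1/Σ_t)·((Φ₀/3 + ε·p(x))/(Φ₀ + ε·q(x)))·(Φ₀ + ε·r(x)) and L(ε, x) = ((ε·s(x) + (ε/Σ_t)·p′(x))/(Φ₀ + ε·q(x)))·(Φ₀ + ε·r(x)). Then for every x: (i) the ε-derivative of K(·, x) at ε = 0 equals −(1/Σ_t)·(r(x)/3 − q(x)/3 + p(x)); (ii) the ε-derivative of L(·, x) at ε = 0 equals s(x) + (1/Σ_t)·p′(x); and (iii) the x-derivative of the function x ↦ ∂_ε K(0, x), added to ∂_ε L(0, x), equals −(1/(3Σ_t))·(r′(x)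 − q′(x)) + s(x). In particular the first-order perturbation of the total CQD current does not depend on the second-moment perturbation p. -/
/-- The derivative at `0` of `((a + ε b) / (c + ε d)) (c + ε e)` as a function of `ε`. -/
theorem hasDerivAt_affine_div_affine_mul_affine {c : ℝ} (hc : c ≠ 0) (a b d e : ℝ) :
    HasDerivAt (fun ε : ℝ => (a + ε * b) / (c + ε * d) * (c + ε * e))
      (b + a / c * (e - d)) 0 := by
  have affine (u v : ℝ) : HasDerivAt (fun ε : ℝ => u + ε * v) v 0 := by
    simpa using ((hasDerivAt_id (0 : ℝ)).mul_const v).const_add u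
  have hden : c + 0 * d ≠ 0 := by simpa using hc
  refine (((affine a b).fun_div (affine c d) hden).fun_mul (affine c e)).congr_deriv ?_
  simp only [zero_mul, add_zero]
  field_simp
  ring

/-- Cancellation of the second-moment perturbation: the linearized CQD current
equals the linearized NDA current. With
`K(ε,x) = -(1/σt)·((Φ₀/3 + ε p(x))/(Φ₀ + ε q(x)))·(Φ₀ + ε r(x))` and
`L(ε,x) = ((ε s(x) + (ε/σt) p′(x))/(Φ₀ + ε q(x)))·(Φ₀ + ε r(x))`:
(i) `∂_ε K(0,x) = -(1/σt)(r/3 - q/3 + p)`;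
(ii) `∂_ε L(0,x) = s + (1/σt) p′`;
(iii) `d/dx ∂_ε K(0,·) + ∂_ε L(0,·) = -(1/(3σt))(r′ - q′) + s`,
which does not depend on the second-moment perturbation `p`. -/
theorem cqd_linearization_equals_nda
    (σt Φ₀ : ℝ) (hσt : 0 < σt) (hΦ₀ : Φ₀ ≠ 0)
    (p q r s : ℝ → ℝ)
    (hp : Differentiable ℝ p) (hq : Differentiable ℝ q) (hr : Differentiable ℝ r)
    (K L : ℝ → ℝ → ℝ)
    (hK : ∀ ε x, K ε x = -(1 / σt) * ((Φ₀ / 3 + ε * p x) / (Φ₀ + ε * q x)) * (Φ₀ + ε * r x))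
    (hL : ∀ ε x, L ε x = ((ε * s x + (ε / σt) * deriv p x) / (Φ₀ + ε * q x)) * (Φ₀ + ε * r x)) :
    (∀ x, deriv (fun ε => K ε x) 0 = -(1 / σt) * (r x / 3 - q x / 3 + p x)) ∧
    (∀ x, deriv (fun ε => L ε x) 0 = s x + (1 / σt) * deriv p x) ∧
    (∀ x, deriv (fun y => deriv (fun ε => K ε y) 0) x + deriv (fun ε => L ε x) 0
        = -(1 / (3 * σt)) * (deriv r x - deriv q x) + s x) := by
  have hK' (x : ℝ) : deriv (fun ε => K ε x) 0 = -(1 / σt) * (r x / 3 - q x / 3 + p x) := by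
    simp only [hK, mul_assoc]
    rw [((hasDerivAt_affine_div_affine_mul_affine hΦ₀ (Φ₀ / 3) (p x) (q x) (r x)).const_mul
      (-(1 / σt))).deriv]
    field_simp
    ring
  have hL' (x : ℝ) : deriv (fun ε => L ε x) 0 = s x + (1 / σt) * deriv p x := by
    have hfun : (fun ε => L ε x) = fun ε =>
        (0 + ε * (s x + (1 / σt) * deriv p x)) / (Φ₀ + ε * q x) * (Φ₀ + ε * r x) := by
      funext ε
      rw [hL]
      ring
    rw [hfun, (hasDerivAt_affine_div_affine_mul_affine hΦ₀ _ _ _ _).deriv]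
    simp
  refine ⟨hK', hL', fun x => ?_⟩
  have hx : HasDerivAt (fun y => -(1 / σt) * (r y / 3 - q y / 3 + p y))
      (-(1 / σt) * (deriv r x / 3 - deriv q x / 3 + deriv p x)) x :=
    ((((hr x).hasDerivAt.div_const 3).fun_sub ((hq x).hasDerivAt.div_const 3)).fun_add
      (hp x).hasDerivAt).const_mul _
  simp only [hK', hL', hx.deriv]
  field_simp
  ring
end
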